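/- Let m ≥ 1, let α₁,…,α_m be real numbers with 0 < α_i < Q for each i, and let α = α₁+⋯+α_m. Then the operator norm of the m-linear Hardy–Littlewood–Pólya operator P_m^h from H^∞_{α₁}(ℍⁿ)×⋯×H^∞_{α_m}(ℍⁿ) to H^∞_α(ℍⁿ) (the least constant C with ‖P_m^h(f₁,…,f_m)‖_{H^∞_α} ≤ C ∏_{i=1}^m ‖f_i‖_{H^∞_{α_i}} for all f_i ∈ H^∞_{α_i}(ℍⁿ)) equals exactly mQω_Q^m / (α ∏_{j=1}^m (Q-α_j)). -/

import Mathlib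

open MeasureTheory ENNReal

/-- The Korányi (homogeneous) norm on the Heisenberg group `ℍⁿ ≃ ℝ^{2n+1}`. -/
noncomputable def hnorm (n : ℕ) (x : Fin (2*n+1) → ℝ) : ℝ :=
  ((∑ i : Fin (2*n+1), if (i : ℕ) < 2*n then (x i)^2 else 0)^2
    + (x (Fin.last (2*n)))^2) ^ ((1:ℝ)/4)

/-- The Heisenberg dilations `δ_r`. -/
noncomputable def dil (n : ℕ) (r : ℝ) (x : Fin (2*n+1) → ℝ) : Fin (2*n+1) → ℝ :=
  fun i => if (i : ℕ) < 2*n then r * x i else r^2 * x i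

/-- The norm of the weighted-type space `H^∞_α(ℍⁿ)`:
`‖f‖ = ess sup_x |x|_h^α |f x|`. -/
noncomputable def wnorm (n : ℕ) (α : ℝ) (f : (Fin (2*n+1) → ℝ) → ℝ) : ℝ≥0∞ :=
  essSup (fun x => ENNReal.ofReal (hnorm n x ^ α * |f x|)) volume

/-- `Ω_Q`: the volume of the Korányi unit ball. -/
noncomputable def ΩQ (n : ℕ) : ℝ :=
  (volume {x : Fin (2*n+1) → ℝ | hnorm n x < 1}).toReal


section helpers
open Set

lemma lintegral_fin_prod_aux {X : Type*} [MeasureSpace X] [SigmaFinite (volume : Measure X)]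
    (m : ℕ) (g : Fin m → X → ℝ≥0∞) (hg : ∀ i, Measurable (g i)) :
    ∫⁻ y : Fin m → X, ∏ i, g i (y i) = ∏ i, ∫⁻ y, g i y := by
  induction m with
  | zero => simp [volume_pi]
  | succ m ih =>
    rw [Fin.prod_univ_succ, ← ih (fun i => g i.succ) (fun i => hg _)]
    rw [← ((volume_preserving_piFinSuccAbove (fun _ : Fin (m+1) => X) 0).symm).lintegral_comp_emb
      (MeasurableEquiv.measurableEmbedding _)]
    simp only [Fin.prod_univ_succ]
    exact lintegral_prod_mul (f := g 0) (g := fun y : Fin m → X => ∏ i : Fin m, g i.succ (y i))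
      (hg 0).aemeasurable
      (Finset.measurable_prod _ fun i _ => (hg _).comp (measurable_pi_apply i)).aemeasurable

lemma lint_Ioi_aux (a r : ℝ) (ha : 0 < a) (hr : 0 < r) :
    ∫⁻ s in Ioi r, ENNReal.ofReal (s ^ (-a - 1)) = ENNReal.ofReal (r ^ (-a) / a) := by
  rw [← ofReal_integral_eq_lintegral_ofReal (integrableOn_Ioi_rpow_of_lt (by linarith) hr),
    integral_Ioi_rpow_of_lt (by linarith) hr]
  · congr 1
    rw [show -a - 1 + 1 = -a by ring]
    rw [neg_div_neg_eq]
  · filter_upwards [ae_restrict_mem measurableSet_Ioi] with s hs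
    exact Real.rpow_nonneg (hr.le.trans (le_of_lt hs)) _

lemma lint_Ioc_aux (b t : ℝ) (hb : 0 < b) (ht : 0 < t) :
    ∫⁻ s in Ioc 0 t, ENNReal.ofReal (s ^ (b - 1)) = ENNReal.ofReal (t ^ b / b) := by
  rw [← ofReal_integral_eq_lintegral_ofReal, ← intervalIntegral.integral_of_le ht.le,
    integral_rpow (by left; linarith)]
  · congr 1
    rw [show b - 1 + 1 = b by ring, Real.zero_rpow hb.ne', sub_zero]
  · exact (intervalIntegrable_iff_integrableOn_Ioc_of_le ht.le).1
      (intervalIntegral.intervalIntegrable_rpow' (by linarith))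
  · filter_upwards [ae_restrict_mem measurableSet_Ioc] with s hs
    exact Real.rpow_nonneg hs.1.le _

/-- layer cake for a negative power -/
lemma layer_aux (a r : ℝ) (ha : 0 < a) (hr : 0 < r) :
    ENNReal.ofReal (r ^ (-a)) =
      ∫⁻ s in Ioi (0:ℝ), ENNReal.ofReal (a * s ^ (-a - 1)) * (if r < s then 1 else 0) := by
  have h1 : ∀ s : ℝ, ENNReal.ofReal (a * s ^ (-a - 1)) * (if r < s then 1 else 0)
      = (Ioi r).indicator (fun s => ENNReal.ofReal a * ENNReal.ofReal (s ^ (-a - 1))) s := by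
    intro s
    by_cases h : r < s
    · simp [h, ENNReal.ofReal_mul ha.le]
    · simp [h]
  simp_rw [h1]
  rw [setLIntegral_indicator measurableSet_Ioi, inter_eq_left.2 (Ioi_subset_Ioi hr.le),
    lintegral_const_mul _ (by fun_prop), lint_Ioi_aux a r ha hr, ← ENNReal.ofReal_mul ha.le]
  congr 1
  field_simp

lemma hS_nonneg (n : ℕ) (x : Fin (2*n+1) → ℝ) :
    0 ≤ ∑ i : Fin (2*n+1), if (i : ℕ) < 2*n then (x i)^2 else 0 :=
  Finset.sum_nonneg fun i _ => by split_ifs <;> positivity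

lemma hnorm_nonneg (n : ℕ) (x) : 0 ≤ hnorm n x := by
  unfold hnorm; positivity

lemma hnorm_measurable (n : ℕ) : Measurable (hnorm n) := by
  have : Continuous (hnorm n) := by
    unfold hnorm
    refine Continuous.rpow_const ?_ (fun _ => Or.inr (by norm_num))
    refine Continuous.add (Continuous.pow (continuous_finsetSum _ fun i _ => ?_) 2) (by fun_prop)
    split_ifs <;> fun_prop
  exact this.measurable

lemma hnorm_pos (n : ℕ) (x) (hx : x ≠ 0) : 0 < hnorm n x := by
  unfold hnorm
  apply Real.rpow_pos_of_pos
  have hS := hS_nonneg n x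
  rcases eq_or_ne (x (Fin.last (2*n))) 0 with h0 | h0
  · have : ∃ i, x i ≠ 0 := by
      by_contra! h; exact hx (funext h)
    obtain ⟨i, hi⟩ := this
    have hlt : (i:ℕ) < 2*n := by
      have := i.2
      by_contra hc
      exact hi (by rw [show i = Fin.last (2*n) from Fin.ext (by simp; omega)]; exact h0)
    have h3 : (x i)^2 ≤ ∑ i : Fin (2*n+1), if (i : ℕ) < 2*n then (x i)^2 else 0 := by
      have := Finset.single_le_sum (f := fun i : Fin (2*n+1) => if (i : ℕ) < 2*n then (x i)^2 else 0)
        (fun i _ => by split_ifs <;> positivity) (Finset.mem_univ i)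
      simpa [hlt] using this
    have : 0 < (x i)^2 := by positivity
    have : 0 < ∑ i : Fin (2*n+1), if (i : ℕ) < 2*n then (x i)^2 else 0 := this.trans_le h3
    positivity
  · positivity

lemma hnorm_dil (n : ℕ) (r : ℝ) (hr : 0 < r) (x) : hnorm n (dil n r x) = r * hnorm n x := by
  unfold hnorm
  have h1 : (∑ i : Fin (2*n+1), if (i : ℕ) < 2*n then (dil n r x i)^2 else 0)
      = r^2 * ∑ i : Fin (2*n+1), if (i : ℕ) < 2*n then (x i)^2 else 0 := by
    rw [Finset.mul_sum]
    refine Finset.sum_congr rfl fun i _ => ?_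
    by_cases h : (i:ℕ) < 2*n
    · simp [h, dil]; ring
    · simp [h]
  have h2 : dil n r x (Fin.last (2*n)) = r^2 * x (Fin.last (2*n)) := by simp [dil]
  rw [h1, h2]
  set S := ∑ i : Fin (2*n+1), if (i : ℕ) < 2*n then (x i)^2 else 0
  rw [show (r^2*S)^2 + (r^2 * x (Fin.last (2*n)))^2 = r^4 * (S^2 + (x (Fin.last (2*n)))^2) by ring,
    Real.mul_rpow (by positivity) (by positivity)]
  congr 1
  rw [← Real.rpow_natCast, ← Real.rpow_mul hr.le]
  norm_num

lemma ball_subset (n : ℕ) : {x : Fin (2*n+1) → ℝ | hnorm n x < 1} ⊆ Metric.closedBall 0 1 := by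
  intro x hx
  have hS := hS_nonneg n x
  have h2 : (∑ i : Fin (2*n+1), if (i : ℕ) < 2*n then (x i)^2 else 0)^2
    + (x (Fin.last (2*n)))^2 < 1 := by
    by_contra! hc
    have := Real.one_le_rpow hc (show (0:ℝ) ≤ 1/4 by norm_num)
    exact absurd hx (not_lt.2 this)
  rw [mem_closedBall_zero_iff, pi_norm_le_iff_of_nonneg zero_le_one]
  intro i
  rw [Real.norm_eq_abs, ← sq_le_one_iff_abs_le_one]
  by_cases hlt : (i:ℕ) < 2*n
  · have h3 : (x i)^2 ≤ ∑ i : Fin (2*n+1), if (i : ℕ) < 2*n then (x i)^2 else 0 := by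
      have := Finset.single_le_sum (f := fun i : Fin (2*n+1) => if (i : ℕ) < 2*n then (x i)^2 else 0)
        (fun i _ => by split_ifs <;> positivity) (Finset.mem_univ i)
      simpa [hlt] using this
    nlinarith [sq_nonneg (x (Fin.last (2*n)))]
  · rw [show i = Fin.last (2*n) from Fin.ext (by simp; omega)]
    nlinarith

lemma volume_ball (n : ℕ) (r : ℝ) (hr : 0 < r) :
    volume {x : Fin (2*n+1) → ℝ | hnorm n x < r} = ENNReal.ofReal (r ^ (2*(n:ℝ)+2) * ΩQ n) := by
  have hfin : volume {x : Fin (2*n+1) → ℝ | hnorm n x < 1} ≠ ⊤ :=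
    ((measure_mono (ball_subset n)).trans_lt measure_closedBall_lt_top).ne
  let D : Fin (2*n+1) → ℝ := fun i => if (i:ℕ) < 2*n then r⁻¹ else r⁻¹^2
  have hD : ∀ x, Matrix.toLin' (Matrix.diagonal D) x = dil n r⁻¹ x := by
    intro x
    ext i
    simp only [Matrix.toLin'_apply, Matrix.mulVec_diagonal, D, dil]
    split_ifs <;> rfl
  have hdet : LinearMap.det (Matrix.toLin' (Matrix.diagonal D)) = (r ^ (2*n+2))⁻¹ := by
    rw [LinearMap.det_toLin', Matrix.det_diagonal, Fin.prod_univ_castSucc]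
    simp [D]
    rw [← mul_inv, ← pow_add]
  have hset : {x : Fin (2*n+1) → ℝ | hnorm n x < r}
      = (Matrix.toLin' (Matrix.diagonal D)) ⁻¹' {x : Fin (2*n+1) → ℝ | hnorm n x < 1} := by
    ext x
    simp only [mem_ofPred_eq, mem_preimage, hD, hnorm_dil n r⁻¹ (inv_pos.2 hr)]
    rw [inv_mul_lt_iff₀ hr, mul_one]
  rw [hset, Measure.addHaar_preimage_linearMap _ (by rw [hdet]; positivity), hdet, inv_inv,
    abs_of_pos (by positivity), ENNReal.ofReal_mul (by positivity), ΩQ,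
    ENNReal.ofReal_toReal hfin]
  congr 2
  rw [← Real.rpow_natCast]; push_cast; rfl

lemma ΩQ_nonneg (n : ℕ) : 0 ≤ ΩQ n := ENNReal.toReal_nonneg

lemma ae_pos (n : ℕ) : ∀ᵐ x : Fin (2*n+1) → ℝ, 0 < hnorm n x := by
  have : ∀ᵐ x : Fin (2*n+1) → ℝ, x ≠ 0 := by
    simp [ae_iff]
  filter_upwards [this] with x hx using hnorm_pos n x hx

lemma lint_ball (n : ℕ) (a t : ℝ) (ha : 0 < a) (haQ : a < 2*n+2) (ht : 0 < t) :
    ∫⁻ y in {y : Fin (2*n+1) → ℝ | hnorm n y < t}, ENNReal.ofReal (hnorm n y ^ (-a)) =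
      ENNReal.ofReal ((2*n+2) * ΩQ n / (2*n+2 - a) * t ^ (2*n+2 - a)) := by
  have hΩ := ΩQ_nonneg n
  have hmh := hnorm_measurable n
  have hb : 0 < 2*(n:ℝ)+2 - a := by linarith
  calc _ = ∫⁻ y in {y : Fin (2*n+1) → ℝ | hnorm n y < t}, ∫⁻ s in Ioi (0:ℝ),
        ENNReal.ofReal (a * s ^ (-a - 1)) * (if hnorm n y < s then 1 else 0) := by
        refine lintegral_congr_ae (ae_restrict_of_ae ?_)
        filter_upwards [ae_pos n] with y hy using layer_aux a _ ha hy
    _ = ∫⁻ s in Ioi (0:ℝ), ∫⁻ y in {y : Fin (2*n+1) → ℝ | hnorm n y < t},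
        ENNReal.ofReal (a * s ^ (-a - 1)) * (if hnorm n y < s then 1 else 0) := by
        apply lintegral_lintegral_swap
        apply Measurable.aemeasurable
        refine Measurable.mul (by fun_prop) ?_
        exact Measurable.ite (measurableSet_lt (by fun_prop) (by fun_prop)) measurable_const
          measurable_const
    _ = ∫⁻ s in Ioi (0:ℝ), ENNReal.ofReal (a * s ^ (-a - 1)) *
          ENNReal.ofReal ((min s t) ^ (2*(n:ℝ)+2) * ΩQ n) := by
        refine setLIntegral_congr_fun measurableSet_Ioi fun s hs => ?_
        have hs : 0 < s := hs
        rw [lintegral_const_mul _ (Measurable.ite (measurableSet_lt (by fun_prop) (by fun_prop))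
          measurable_const measurable_const)]
        congr 1
        rw [← volume_ball n _ (lt_min hs ht)]
        have : ∀ y : Fin (2*n+1) → ℝ, (if hnorm n y < s then (1:ℝ≥0∞) else 0)
            = {y : Fin (2*n+1) → ℝ | hnorm n y < s}.indicator 1 y := by
          intro y; simp [indicator]
        simp_rw [this]
        have hms : MeasurableSet {y : Fin (2*n+1) → ℝ | hnorm n y < s} :=
          measurableSet_lt (by fun_prop) (by fun_prop)
        rw [lintegral_indicator_one hms, Measure.restrict_apply hms]
        congr 1
        ext y; simp
    _ = (∫⁻ s in Ioc (0:ℝ) t, ENNReal.ofReal (a * s ^ (-a - 1)) *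
          ENNReal.ofReal ((min s t) ^ (2*(n:ℝ)+2) * ΩQ n)) +
        ∫⁻ s in Ioi t, ENNReal.ofReal (a * s ^ (-a - 1)) *
          ENNReal.ofReal ((min s t) ^ (2*(n:ℝ)+2) * ΩQ n) := by
        rw [← lintegral_union measurableSet_Ioi, Ioc_union_Ioi_eq_Ioi ht.le]
        exact Set.disjoint_left.2 fun s h1 h2 => not_lt.2 h1.2 h2
    _ = (∫⁻ s in Ioc (0:ℝ) t, ENNReal.ofReal (a * ΩQ n) *
          ENNReal.ofReal (s ^ ((2*(n:ℝ)+2 - a) - 1))) +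
        ∫⁻ s in Ioi t, ENNReal.ofReal (a * (t ^ (2*(n:ℝ)+2) * ΩQ n)) *
          ENNReal.ofReal (s ^ (-a - 1)) := by
        congr 1
        · refine setLIntegral_congr_fun measurableSet_Ioc fun s hs => ?_
          have hs0 : 0 < s := hs.1
          rw [min_eq_left hs.2, ← ENNReal.ofReal_mul (by positivity),
            ← ENNReal.ofReal_mul (by positivity)]
          congr 1
          rw [show (2*(n:ℝ)+2 - a) - 1 = (-a - 1) + (2*(n:ℝ)+2) by ring, Real.rpow_add hs0 (-a - 1)]
          ring
        · refine setLIntegral_congr_fun measurableSet_Ioi fun s hs => ?_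
          have hs' : t < s := hs
          have hs0 : 0 < s := ht.trans hs'
          rw [min_eq_right hs'.le, ← ENNReal.ofReal_mul (by positivity),
            ← ENNReal.ofReal_mul (by positivity)]
          congr 1
          ring
    _ = _ := by
        rw [lintegral_const_mul _ (by fun_prop), lintegral_const_mul _ (by fun_prop),
          lint_Ioc_aux _ _ hb ht, lint_Ioi_aux _ _ ha ht, ← ENNReal.ofReal_mul (by positivity),
          ← ENNReal.ofReal_mul (by positivity), ← ENNReal.ofReal_add (by positivity) (by positivity)]
        congr 1
        generalize 2*(n:ℝ)+2 = q at *
        obtain ⟨b, rfl⟩ : ∃ b, q = b + a := ⟨q - a, by ring⟩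
        simp only [add_sub_cancel_right] at hb ⊢
        rw [show t ^ b = t ^ (b+a) * t ^ (-a) by rw [← Real.rpow_add ht]; congr 1; ring]
        field_simp
        ring

end helpers

section helpers2
open Set

lemma main_lint (n m : ℕ) (hm : 1 ≤ m) (α : Fin m → ℝ) (Q : ℝ) (hQ : Q = 2*n+2)
    (hα : ∀ i, 0 < α i ∧ α i < Q) (x : Fin (2*n+1) → ℝ) (hx : 0 < hnorm n x) :
    ∫⁻ y : Fin m → Fin (2*n+1) → ℝ, (∏ i, ENNReal.ofReal (hnorm n (y i) ^ (-α i))) *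
      ENNReal.ofReal (((max (hnorm n x ^ Q) (⨆ i, hnorm n (y i) ^ Q)) ^ m)⁻¹)
    = ENNReal.ofReal (m * Q * (Q * ΩQ n) ^ m / ((∑ i, α i) * ∏ j, (Q - α j))
        * hnorm n x ^ (-∑ i, α i)) := by
  have hΩ := ΩQ_nonneg n
  have hmh := hnorm_measurable n
  have hQ0 : 0 < Q := by rw [hQ]; positivity
  have hmpos : (0:ℝ) < m := by exact_mod_cast hm
  have : Nonempty (Fin m) := ⟨⟨0, hm⟩⟩
  have hA : 0 < ∑ i, α i := Finset.sum_pos (fun i _ => (hα i).1) Finset.univ_nonempty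
  have hr : 0 < hnorm n x ^ Q := by positivity
  have hprod : ∀ j, 0 < Q - α j := fun j => by linarith [(hα j).2]
  set r := hnorm n x ^ Q with hrdef
  have hDm : Measurable fun y : Fin m → Fin (2*n+1) → ℝ => max r (⨆ i, hnorm n (y i) ^ Q) := by
    refine measurable_const.max (Measurable.iSup fun i => ?_)
    exact (hmh.comp (measurable_pi_apply i)).pow_const _
  have hgm : Measurable fun y : Fin m → Fin (2*n+1) → ℝ =>
      ∏ i, ENNReal.ofReal (hnorm n (y i) ^ (-α i)) := by
    refine Finset.measurable_prod _ fun i _ => ?_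
    exact ((hmh.comp (measurable_pi_apply i)).pow_const _).ennreal_ofReal
  have hDlt : ∀ (y : Fin m → Fin (2*n+1) → ℝ) (u : ℝ), 0 < u →
      (if max r (⨆ i, hnorm n (y i) ^ Q) < u then (1:ℝ≥0∞) else 0)
        = (if r < u then 1 else 0) * ∏ i, (if hnorm n (y i) < u ^ (1/Q) then 1 else 0) := by
    intro y u hu
    have h1 : (max r (⨆ i, hnorm n (y i) ^ Q) < u) ↔
        r < u ∧ ∀ i, hnorm n (y i) < u ^ (1/Q) := by
      rw [max_lt_iff]
      refine and_congr_right fun _ => ?_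
      have h2 : ∀ i, hnorm n (y i) < u ^ (1/Q) ↔ hnorm n (y i) ^ Q < u := fun i => by
        rw [one_div, Real.lt_rpow_inv_iff_of_pos (hnorm_nonneg n _) hu.le hQ0]
      simp_rw [h2]
      constructor
      · intro h i
        exact (le_ciSup (f := fun i => hnorm n (y i) ^ Q) (Set.finite_range _).bddAbove i).trans_lt h
      · intro h
        obtain ⟨i, hi⟩ := exists_eq_ciSup_of_finite (f := fun i => hnorm n (y i) ^ Q)
        rw [← hi]; exact h i
    by_cases hru : r < u
    · by_cases hall : ∀ i, hnorm n (y i) < u ^ (1/Q)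
      · rw [if_pos (h1.2 ⟨hru, hall⟩), if_pos hru, one_mul]
        exact (Finset.prod_eq_one fun i _ => if_pos (hall i)).symm
      · rw [if_neg (by rw [h1]; exact fun h => hall h.2)]
        push Not at hall
        obtain ⟨i, hi⟩ := hall
        rw [Finset.prod_eq_zero (Finset.mem_univ i) (if_neg (not_lt.2 hi)), mul_zero]
    · rw [if_neg (by rw [h1]; exact fun h => hru h.1), if_neg hru, zero_mul]
  set c : ℝ := ∏ i, (Q * ΩQ n / (Q - α i)) with hc
  have hc0 : 0 ≤ c := Finset.prod_nonneg fun i _ => by have := hprod i; positivity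
  calc _ = ∫⁻ y : Fin m → Fin (2*n+1) → ℝ, ∫⁻ u in Ioi (0:ℝ),
        (∏ i, ENNReal.ofReal (hnorm n (y i) ^ (-α i))) *
          (ENNReal.ofReal (m * u ^ (-(m:ℝ) - 1)) *
            (if max r (⨆ i, hnorm n (y i) ^ Q) < u then 1 else 0)) := by
        refine lintegral_congr fun y => ?_
        have hD : 0 < max r (⨆ i, hnorm n (y i) ^ Q) := lt_max_of_lt_left hr
        rw [lintegral_const_mul, ← layer_aux _ _ hmpos hD, Real.rpow_neg hD.le,
          Real.rpow_natCast]
        exact Measurable.mul (by fun_prop) (Measurable.ite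
          (measurableSet_lt measurable_const measurable_id) measurable_const measurable_const)
    _ = ∫⁻ u in Ioi (0:ℝ), ∫⁻ y : Fin m → Fin (2*n+1) → ℝ,
        (∏ i, ENNReal.ofReal (hnorm n (y i) ^ (-α i))) *
          (ENNReal.ofReal (m * u ^ (-(m:ℝ) - 1)) *
            (if max r (⨆ i, hnorm n (y i) ^ Q) < u then 1 else 0)) := by
        apply lintegral_lintegral_swap
        apply Measurable.aemeasurable
        refine (hgm.comp measurable_fst).mul (Measurable.mul (by fun_prop) ?_)
        exact Measurable.ite (measurableSet_lt (hDm.comp measurable_fst) measurable_snd)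
          measurable_const measurable_const
    _ = ∫⁻ u in Ioi (0:ℝ), (Ioi r).indicator (fun u => ENNReal.ofReal (m * c) *
          ENNReal.ofReal (u ^ (-((∑ i, α i) / Q) - 1))) u := by
        refine setLIntegral_congr_fun measurableSet_Ioi fun u hu => ?_
        have hu : 0 < u := hu
        have ht : 0 < u ^ (1/Q) := by positivity
        have e1 : ∀ y : Fin m → Fin (2*n+1) → ℝ,
            (∏ i, ENNReal.ofReal (hnorm n (y i) ^ (-α i))) *
              (ENNReal.ofReal (m * u ^ (-(m:ℝ) - 1)) *
                (if max r (⨆ i, hnorm n (y i) ^ Q) < u then 1 else 0))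
            = (ENNReal.ofReal (m * u ^ (-(m:ℝ) - 1)) * (if r < u then 1 else 0)) *
              ∏ i, {z : Fin (2*n+1) → ℝ | hnorm n z < u ^ (1/Q)}.indicator
                (fun z => ENNReal.ofReal (hnorm n z ^ (-α i))) (y i) := by
          intro y
          rw [hDlt y u hu]
          have : ∀ i, {z : Fin (2*n+1) → ℝ | hnorm n z < u ^ (1/Q)}.indicator
                (fun z => ENNReal.ofReal (hnorm n z ^ (-α i))) (y i)
              = ENNReal.ofReal (hnorm n (y i) ^ (-α i)) *
                (if hnorm n (y i) < u ^ (1/Q) then 1 else 0) := by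
            intro i
            by_cases h : hnorm n (y i) < u ^ (1/Q) <;> simp [h, -one_div]
          simp_rw [this, Finset.prod_mul_distrib]
          ring
        have hms : MeasurableSet {z : Fin (2*n+1) → ℝ | hnorm n z < u ^ (1/Q)} :=
          measurableSet_lt hmh measurable_const
        have hgi : ∀ i, Measurable ({z : Fin (2*n+1) → ℝ | hnorm n z < u ^ (1/Q)}.indicator
                (fun z => ENNReal.ofReal (hnorm n z ^ (-α i)))) := fun i =>
          ((hmh.pow_const _).ennreal_ofReal).indicator hms
        simp_rw [e1]
        have hpm : Measurable fun y : Fin m → Fin (2*n+1) → ℝ =>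
            ∏ i, {z : Fin (2*n+1) → ℝ | hnorm n z < u ^ (1/Q)}.indicator
                (fun z => ENNReal.ofReal (hnorm n z ^ (-α i))) (y i) :=
          Finset.measurable_prod _ fun i _ => (hgi i).comp (measurable_pi_apply i)
        rw [lintegral_const_mul _ hpm,
          lintegral_fin_prod_aux m (fun i => {z : Fin (2*n+1) → ℝ | hnorm n z < u ^ (1/Q)}.indicator
                (fun z => ENNReal.ofReal (hnorm n z ^ (-α i)))) hgi]
        have e2 : ∀ i, ∫⁻ z, {z : Fin (2*n+1) → ℝ | hnorm n z < u ^ (1/Q)}.indicator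
                (fun z => ENNReal.ofReal (hnorm n z ^ (-α i))) z
            = ENNReal.ofReal (Q * ΩQ n / (Q - α i) * u ^ (1 - α i / Q)) := by
          intro i
          rw [lintegral_indicator hms, lint_ball n (α i) _ (hα i).1 (hQ ▸ (hα i).2) ht, ← hQ,
            ← Real.rpow_mul hu.le]
          congr 3
          field_simp
        simp_rw [e2]
        rw [← ENNReal.ofReal_prod_of_nonneg (fun i _ => by have := hprod i; positivity),
          Finset.prod_mul_distrib, ← hc, ← Real.rpow_sum_of_pos hu]
        by_cases hru : r < u
        · rw [if_pos hru, mul_one, indicator_of_mem (mem_Ioi.2 hru),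
            ← ENNReal.ofReal_mul (by positivity), ← ENNReal.ofReal_mul (by positivity)]
          congr 1
          have : u ^ (-((∑ i, α i) / Q) - 1) = u ^ (-(m:ℝ) - 1) * u ^ (∑ i, (1 - α i / Q)) := by
            rw [← Real.rpow_add hu]
            congr 1
            rw [Finset.sum_sub_distrib, ← Finset.sum_div]
            simp
            ring
          rw [this]; ring
        · rw [if_neg hru, mul_zero, zero_mul, indicator_of_notMem (by simpa using hru)]
    _ = _ := by
        rw [setLIntegral_indicator measurableSet_Ioi, inter_eq_left.2 (Ioi_subset_Ioi hr.le),
          lintegral_const_mul _ (by fun_prop), lint_Ioi_aux _ _ (by positivity) hr,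
          ← ENNReal.ofReal_mul (by positivity)]
        congr 1
        rw [hrdef, ← Real.rpow_mul hx.le, hc, Finset.prod_div_distrib, Finset.prod_const,
          Finset.card_univ, Fintype.card_fin,
          show Q * -((∑ i, α i) / Q) = -∑ i, α i by field_simp]
        have : ∏ j, (Q - α j) ≠ 0 := (Finset.prod_pos fun j _ => hprod j).ne'
        field_simp

end helpers2

/-- the operator norm of the `m`-linear Hardy–Littlewood–Pólya operator
on the Heisenberg group equals `mQω_Q^m / (α ∏ (Q - α_j))`. -/
theorem statement11 (n : ℕ) (hn : 1 ≤ n) (m : ℕ) (hm : 1 ≤ m)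
    (Q : ℝ) (hQ : Q = 2*n+2) (ω : ℝ) (hω : ω = Q * ΩQ n)
    (α : Fin m → ℝ) (hα : ∀ i, 0 < α i ∧ α i < Q) :
    IsLeast {C : ℝ≥0∞ | ∀ f : Fin m → (Fin (2*n+1) → ℝ) → ℝ,
        (∀ i, Measurable (f i)) → (∀ i, ∀ y, 0 ≤ f i y) →
        (∀ i, wnorm n (α i) (f i) < ⊤) →
        wnorm n (∑ i, α i)
            (fun x => ∫ y : Fin m → Fin (2*n+1) → ℝ,
              (∏ i, f i (y i)) / (max (hnorm n x ^ Q) (⨆ i, hnorm n (y i) ^ Q)) ^ m)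
          ≤ C * ∏ i, wnorm n (α i) (f i)}
      (ENNReal.ofReal (m * Q * ω ^ m / ((∑ i, α i) * ∏ j, (Q - α j)))) := by
  subst hω
  have hΩ := ΩQ_nonneg n
  have hmh := hnorm_measurable n
  have hQ0 : 0 < Q := by rw [hQ]; positivity
  have : Nonempty (Fin m) := ⟨⟨0, hm⟩⟩
  have hA : 0 < ∑ i, α i := Finset.sum_pos (fun i _ => (hα i).1) Finset.univ_nonempty
  have hprod : 0 < ∏ j, (Q - α j) := Finset.prod_pos fun j _ => by linarith [(hα j).2]
  set K : ℝ := m * Q * (Q * ΩQ n) ^ m / ((∑ i, α i) * ∏ j, (Q - α j)) with hK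
  have hK0 : 0 ≤ K := by positivity
  have hD0 : ∀ (x : Fin (2*n+1) → ℝ) (y : Fin m → Fin (2*n+1) → ℝ),
      0 ≤ (max (hnorm n x ^ Q) (⨆ i, hnorm n (y i) ^ Q)) ^ m := fun x y => by
    have := hnorm_nonneg n x
    exact pow_nonneg (le_max_of_le_left (by positivity)) _
  have hcancel : ∀ x : Fin (2*n+1) → ℝ, 0 < hnorm n x →
      hnorm n x ^ (∑ i, α i) * (K * hnorm n x ^ (-∑ i, α i)) = K := fun x hx => by
    rw [mul_left_comm, ← Real.rpow_add hx]; simp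
  constructor
  · intro f hfm hf0 hfin
    refine essSup_le_of_ae_le _ ?_
    filter_upwards [ae_pos n] with x hx
    have hx0 := hx.le
    have hb : ∀ i, ∀ᵐ z : Fin (2*n+1) → ℝ, ENNReal.ofReal (f i z) ≤
        wnorm n (α i) (f i) * ENNReal.ofReal (hnorm n z ^ (-α i)) := by
      intro i
      filter_upwards [ae_pos n, ENNReal.ae_le_essSup (μ := volume)
        (fun z => ENNReal.ofReal (hnorm n z ^ (α i) * |f i z|))] with z hz hz2
      calc ENNReal.ofReal (f i z) = ENNReal.ofReal (hnorm n z ^ (α i) * |f i z|) *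
            ENNReal.ofReal (hnorm n z ^ (-α i)) := by
            rw [← ENNReal.ofReal_mul (by positivity), abs_of_nonneg (hf0 i z), mul_right_comm,
              ← Real.rpow_add hz]
            simp
        _ ≤ _ := mul_le_mul_left hz2 _
    have hb2 : ∀ᵐ y : Fin m → Fin (2*n+1) → ℝ, ∀ i, ENNReal.ofReal (f i (y i)) ≤
        wnorm n (α i) (f i) * ENNReal.ofReal (hnorm n (y i) ^ (-α i)) := by
      rw [ae_all_iff]
      intro i
      exact (Measure.quasiMeasurePreserving_eval (fun _ : Fin m => (volume : Measure (Fin (2*n+1) → ℝ))) i).ae (hb i)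
    have hint : ENNReal.ofReal |∫ y : Fin m → Fin (2*n+1) → ℝ,
              (∏ i, f i (y i)) / (max (hnorm n x ^ Q) (⨆ i, hnorm n (y i) ^ Q)) ^ m|
        ≤ (∏ i, wnorm n (α i) (f i)) * ENNReal.ofReal (K * hnorm n x ^ (-∑ i, α i)) := by
      rw [← Real.enorm_eq_ofReal_abs]
      refine (enorm_integral_le_lintegral_enorm _).trans ?_
      rw [hK, ← main_lint n m hm α Q hQ hα x hx, ← lintegral_const_mul' _ _
        (ENNReal.prod_ne_top fun i _ => (hfin i).ne)]
      refine lintegral_mono_ae ?_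
      filter_upwards [hb2] with y hy
      rw [Real.enorm_of_nonneg (div_nonneg (Finset.prod_nonneg fun i _ => hf0 i _) (hD0 x y)),
        div_eq_mul_inv, ENNReal.ofReal_mul (Finset.prod_nonneg fun i _ => hf0 i _),
        ENNReal.ofReal_prod_of_nonneg (fun i _ => hf0 i _), ← mul_assoc,
        ← Finset.prod_mul_distrib]
      exact mul_le_mul_left (Finset.prod_le_prod' fun i _ => hy i) _
    calc _ = ENNReal.ofReal (hnorm n x ^ (∑ i, α i)) * ENNReal.ofReal |∫ y : Fin m → Fin (2*n+1) → ℝ,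
              (∏ i, f i (y i)) / (max (hnorm n x ^ Q) (⨆ i, hnorm n (y i) ^ Q)) ^ m| :=
          ENNReal.ofReal_mul (by positivity)
      _ ≤ ENNReal.ofReal (hnorm n x ^ (∑ i, α i)) *
          ((∏ i, wnorm n (α i) (f i)) * ENNReal.ofReal (K * hnorm n x ^ (-∑ i, α i))) :=
          mul_le_mul_right hint _
      _ = _ := by
          rw [mul_left_comm, ← ENNReal.ofReal_mul (by positivity), hcancel x hx, mul_comm]
  · intro C hC
    let f : Fin m → (Fin (2*n+1) → ℝ) → ℝ := fun i z => hnorm n z ^ (-α i)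
    have hf0 : ∀ i z, 0 ≤ f i z := fun i z => Real.rpow_nonneg (hnorm_nonneg n z) _
    have hfm : ∀ i, Measurable (f i) := fun i => hmh.pow_const _
    have hw : ∀ i, wnorm n (α i) (f i) ≤ 1 := by
      intro i
      refine essSup_le_of_ae_le _ ?_
      filter_upwards [ae_pos n] with z hz
      rw [abs_of_nonneg (hf0 i z), ← Real.rpow_add hz]
      simp
    have h := hC f hfm hf0 (fun i => (hw i).trans_lt ENNReal.one_lt_top)
    have hle : C * ∏ i, wnorm n (α i) (f i) ≤ C := by
      calc _ ≤ C * 1 := mul_le_mul_right (Finset.prod_le_one' fun i _ => hw i) _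
        _ = C := mul_one C
    refine le_trans (le_of_eq ?_) (h.trans hle)
    rw [wnorm, ← essSup_const' (μ := (volume : Measure (Fin (2*n+1) → ℝ))) (ENNReal.ofReal K)]
    refine essSup_congr_ae ?_
    filter_upwards [ae_pos n] with x hx
    have hDm : Measurable fun y : Fin m → Fin (2*n+1) → ℝ =>
        max (hnorm n x ^ Q) (⨆ i, hnorm n (y i) ^ Q) := by
      refine measurable_const.max (Measurable.iSup fun i => ?_)
      exact (hmh.comp (measurable_pi_apply i)).pow_const _
    have hpm : Measurable fun y : Fin m → Fin (2*n+1) → ℝ => ∏ i, f i (y i) :=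
      Finset.measurable_prod _ fun i _ => (hfm i).comp (measurable_pi_apply i)
    have hval : ∫ y : Fin m → Fin (2*n+1) → ℝ,
              (∏ i, f i (y i)) / (max (hnorm n x ^ Q) (⨆ i, hnorm n (y i) ^ Q)) ^ m
        = K * hnorm n x ^ (-∑ i, α i) := by
      rw [integral_eq_lintegral_of_nonneg_ae (Filter.Eventually.of_forall fun y =>
        div_nonneg (Finset.prod_nonneg fun i _ => hf0 i _) (hD0 x y))
        (hpm.div (hDm.pow_const m)).aestronglyMeasurable]
      have := main_lint n m hm α Q hQ hα x hx
      rw [← hK] at this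
      rw [← ENNReal.toReal_ofReal (show 0 ≤ K * hnorm n x ^ (-∑ i, α i) by positivity), ← this]
      congr 1
      refine lintegral_congr fun y => ?_
      rw [div_eq_mul_inv, ENNReal.ofReal_mul (Finset.prod_nonneg fun i _ => hf0 i _),
        ENNReal.ofReal_prod_of_nonneg (fun i _ => hf0 i _)]
    rw [hval, abs_of_nonneg (by positivity), hcancel x hx]
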